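/- arXiv:2604.07515 — 2 statements merged into one kernel-verified Lean document; each statement's English description precedes it below -/
import Mathlib

section
/- Let G=(V,E) be a finite simple graph on n vertices, let E_+ be a set of non-edges of G, let E_- ⊆ E, set E_new = (E ∪ E_+) \ E_-, and let b = |E_+| + |E_-|. For a permutation π drawn uniformly at random from all permutations of V, the expected recourse satisfies E[|LFMIS((V,E),π) △ LFMIS((V,E_new),π)|] ≤ b, where △ denotes symmetric difference of vertex sets. -/
open Finset

/-- `lfmisAux W E π i` : the vertex at π-position `i` is in the greedy
lexicographically-first MIS of the graph with vertex set `W` and edge set `E`. -/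
def lfmisAux {n : ℕ} (W : Set (Fin n)) (E : Set (Sym2 (Fin n))) (π : Equiv.Perm (Fin n))
    (i : ℕ) : Prop :=
  (∃ h : i < n, π ⟨i, h⟩ ∈ W) ∧
    ∀ j, j < i →
      (∃ (h1 : j < n) (h2 : i < n), π ⟨j, h1⟩ ∈ W ∧ π ⟨i, h2⟩ ∈ W ∧
        s(π ⟨j, h1⟩, π ⟨i, h2⟩) ∈ E) → ¬ lfmisAux W E π j
termination_by i

/-- The lexicographically-first MIS of the graph with vertex set `W ⊆ Fin n`
and edge set `E`, under the permutation `π` (position `i` holds vertex `π i`). -/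
def LFMISOn {n : ℕ} (W : Set (Fin n)) (E : Set (Sym2 (Fin n)))
    (π : Equiv.Perm (Fin n)) : Set (Fin n) :=
  {v | v ∈ W ∧ lfmisAux W E π (π.symm v : ℕ)}

/-- State of the `InfluenceMIS` procedure: alive vertices, surviving edges,
undecided vertices, undecided edges. -/
structure MISState (n : ℕ) where
  verts : Finset (Fin n)
  edges : Finset (Sym2 (Fin n))
  uV : Finset (Fin n)
  uE : Finset (Sym2 (Fin n))

/-- Current neighbors of `u`. -/
def MISState.nbrs {n : ℕ} (st : MISState n) (u : Fin n) : Finset (Fin n) :=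
  st.verts.filter fun v => v ≠ u ∧ s(u, v) ∈ st.edges

/-- One iteration of `InfluenceMIS`, processing vertex `u`.  If `u` is not alive,
nothing happens.  If `u` is undecided, all of its neighbors become undecided and
`u` is deleted (it joins the influence set).  Otherwise `u` is (implicitly) added
to the MIS: its neighbors along undecided edges become undecided, its neighbors
along decided edges are deleted, and `u` is deleted. -/
def stepInf {n : ℕ} (st : MISState n) (u : Fin n) : MISState n :=
  if u ∉ st.verts then st
  else if u ∈ st.uV then
    { verts := st.verts.erase u
      edges := st.edges.filter fun e => u ∉ e
      uV := (st.uV ∪ st.nbrs u).erase u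
      uE := st.uE.filter fun e => u ∉ e }
  else
    let D := (st.nbrs u).filter fun v => s(u, v) ∉ st.uE
    let U := (st.nbrs u).filter fun v => s(u, v) ∈ st.uE
    { verts := (st.verts.erase u) \ D
      edges := st.edges.filter fun e => u ∉ e ∧ ∀ v ∈ D, v ∉ e
      uV := ((st.uV ∪ U) \ D).erase u
      uE := st.uE.filter fun e => u ∉ e ∧ ∀ v ∈ D, v ∉ e }

/-- `stateAt π st0 i` : the state at the beginning of (0-based) iteration `i`
of `InfluenceMIS` started from `st0`, where position `i` holds vertex `π i`
(so 1-based iteration `i` of the paper corresponds to `stateAt π st0 (i-1)`). -/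
def stateAt {n : ℕ} (π : Equiv.Perm (Fin n)) (st0 : MISState n) : ℕ → MISState n
  | 0 => st0
  | i + 1 => if h : i < n then stepInf (stateAt π st0 i) (π ⟨i, h⟩) else stateAt π st0 i

/-- The influence set returned by `InfluenceMIS`: vertices that are alive and
undecided at the beginning of their own iteration. -/
def influenceMIS {n : ℕ} (π : Equiv.Perm (Fin n)) (st0 : MISState n) : Finset (Fin n) :=
  Finset.univ.filter fun v =>
    v ∈ (stateAt π st0 (π.symm v : ℕ)).verts ∧ v ∈ (stateAt π st0 (π.symm v : ℕ)).uV

/-- Initial state of `InfluenceMIS` on a graph `G` with undecided vertices `uV`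
and undecided edges `uE`. -/
def initState {n : ℕ} (G : SimpleGraph (Fin n)) [DecidableRel G.Adj]
    (uV : Finset (Fin n)) (uE : Finset (Sym2 (Fin n))) : MISState n :=
  ⟨Finset.univ, G.edgeFinset, uV, uE⟩

/-- One greedy step on the set `A` of available vertices: if `u` is available, it is selected and
removed together with its neighbours. -/
def greedyStep {n : ℕ} (E : Finset (Sym2 (Fin n))) (A : Finset (Fin n)) (u : Fin n) :
    Finset (Fin n) :=
  if u ∈ A then A.filter fun v => v ≠ u ∧ s(u, v) ∉ E else A

/-- The vertices still available after the greedy algorithm has scanned the first `i` positions. -/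
def available {n : ℕ} (E : Finset (Sym2 (Fin n))) (π : Equiv.Perm (Fin n)) : ℕ → Finset (Fin n)
  | 0 => univ
  | i + 1 => if h : i < n then greedyStep E (available E π i) (π ⟨i, h⟩) else available E π i

theorem mem_available {n : ℕ} (E : Finset (Sym2 (Fin n))) (π : Equiv.Perm (Fin n)) (v : Fin n)
    {i : ℕ} (hi : i ≤ n) :
    v ∈ available E π i ↔ i ≤ (π.symm v : ℕ) ∧
      ∀ j (h : j < n), j < i → π ⟨j, h⟩ ∈ available E π j → s(π ⟨j, h⟩, v) ∉ E := by
  induction i with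
  | zero => simp [available]
  | succ i ih =>
    have hin : i < n := hi
    have hv : v = π ⟨i, hin⟩ ↔ (π.symm v : ℕ) = i := by
      rw [← Equiv.symm_apply_eq, Fin.ext_iff]
    specialize ih hin.le
    have hself := hv.not
    rw [available, dif_pos hin, greedyStep]
    constructor
    · intro h
      have hmem : v ∈ available E π i := by
        split_ifs at h with hu
        · exact (mem_filter.1 h).1
        · exact h
      have hne : v ≠ π ⟨i, hin⟩ := by
        rintro rfl
        split_ifs at h
        exact (mem_filter.1 h).2.1 rfl
      obtain ⟨h1, h2⟩ := ih.1 hmem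
      refine ⟨by have := hself.1 hne; omega, fun j hj hji hjm => ?_⟩
      rcases Nat.lt_succ_iff_lt_or_eq.1 hji with hlt | rfl
      · exact h2 j hj hlt hjm
      · rw [if_pos hjm] at h
        exact (mem_filter.1 h).2.2
    · rintro ⟨h1, h2⟩
      have hmem : v ∈ available E π i :=
        ih.2 ⟨by omega, fun j hj hji => h2 j hj (by omega)⟩
      split_ifs with hu
      · exact mem_filter.2 ⟨hmem, hself.2 (by omega), h2 i hin (by omega) hu⟩
      · exact hmem

theorem lfmisAux_univ_iff {n : ℕ} (E : Finset (Sym2 (Fin n))) (π : Equiv.Perm (Fin n))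
    (i : ℕ) (hi : i < n) :
    lfmisAux Set.univ (E : Set (Sym2 (Fin n))) π i ↔ π ⟨i, hi⟩ ∈ available E π i := by
  induction i using Nat.strong_induction_on with
  | _ i ih =>
    rw [lfmisAux, mem_available E π _ hi.le]
    simp only [Set.mem_univ, true_and, mem_coe, Equiv.symm_apply_apply, le_refl]
    constructor
    · rintro ⟨-, h⟩ j hj hji hjm he
      exact h j hji ⟨hj, hi, he⟩ ((ih j hji hj).2 hjm)
    · intro h
      refine ⟨⟨hi, trivial⟩, ?_⟩
      rintro j hji ⟨hj, _, he⟩ hjm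
      exact h j hj hji ((ih j hji hj).1 hjm) he

theorem available_mul_swap {n : ℕ} (E : Finset (Sym2 (Fin n))) (π : Equiv.Perm (Fin n))
    (a b : Fin n) (i : ℕ) (ha : i ≤ a) (hb : i ≤ b) :
    available E (π * Equiv.swap a b) i = available E π i := by
  induction i with
  | zero => rfl
  | succ i ih =>
    have hin : i < n := by omega
    rw [available, available, dif_pos hin, dif_pos hin, ih (by omega) (by omega),
      Equiv.Perm.mul_apply, Equiv.swap_apply_of_ne_of_ne] <;>
    · rw [Ne, Fin.ext_iff]
      simp only
      omega

/-- The potential of a pair of available sets: the number of vertices available in exactly one of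
them plus the number of edges of `U` spanned by their union. -/
def potential {n : ℕ} (U : Finset (Sym2 (Fin n))) (A B : Finset (Fin n)) : ℕ :=
  (symmDiff A B).card + (U.filter fun e => ∀ v ∈ e, v ∈ A ∪ B).card

/-- The increase of the potential when `u` is scanned, plus one if `u` is selected by exactly one
of the two greedy algorithms. -/
def drift {n : ℕ} (E F : Finset (Sym2 (Fin n))) (A B : Finset (Fin n)) (u : Fin n) : ℤ :=
  (if u ∈ symmDiff A B then 1 else 0) +
    potential (symmDiff E F) (greedyStep E A u) (greedyStep F B u) -
    potential (symmDiff E F) A B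

theorem drift_eq_zero {n : ℕ} (E F : Finset (Sym2 (Fin n))) {A B : Finset (Fin n)} {u : Fin n}
    (hA : u ∉ A) (hB : u ∉ B) : drift E F A B u = 0 := by
  simp [drift, greedyStep, hA, hB, mem_symmDiff]

/-- The contribution of `v` to the drift caused by scanning `u`. -/
def pairDrift {n : ℕ} (E F : Finset (Sym2 (Fin n))) (A B : Finset (Fin n)) (u v : Fin n) : ℤ :=
  if u ∈ A ∪ B ∧ v ∈ A ∪ B ∧ v ≠ u then
    (if v ∈ symmDiff (greedyStep E A u) (greedyStep F B u) then 1 else 0) -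
      (if v ∈ symmDiff A B then 1 else 0) - (if s(u, v) ∈ symmDiff E F then 1 else 0)
  else 0

theorem pairDrift_add_swap_nonpos {n : ℕ} (E F : Finset (Sym2 (Fin n))) (A B : Finset (Fin n))
    (u v : Fin n) : pairDrift E F A B u v + pairDrift E F A B v u ≤ 0 := by
  by_cases huv : v = u
  · simp [pairDrift, huv]
  have hvu : u ≠ v := fun h => huv h.symm
  simp only [pairDrift, greedyStep, mem_symmDiff, mem_union, Sym2.eq_swap (a := v) (b := u)]
  by_cases h1 : u ∈ A <;> by_cases h2 : u ∈ B <;> by_cases h3 : v ∈ A <;> by_cases h4 : v ∈ B <;>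
    by_cases h5 : s(u, v) ∈ E <;> by_cases h6 : s(u, v) ∈ F <;>
    simp [h1, h2, h3, h4, h5, h6, huv, hvu, Sym2.eq_swap (a := v) (b := u)]

theorem greedyStep_subset {n : ℕ} (E : Finset (Sym2 (Fin n))) (A : Finset (Fin n)) (u : Fin n) :
    greedyStep E A u ⊆ A := by
  unfold greedyStep
  split_ifs
  · exact filter_subset _ _
  · exact Subset.rfl

theorem notMem_greedyStep {n : ℕ} (E : Finset (Sym2 (Fin n))) (A : Finset (Fin n)) (u : Fin n) :
    u ∉ greedyStep E A u := by
  unfold greedyStep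
  split_ifs with h
  · simp
  · exact h

theorem drift_le_sum_pairDrift {n : ℕ} (E F : Finset (Sym2 (Fin n))) (A B : Finset (Fin n))
    (u : Fin n) : drift E F A B u ≤ ∑ v, pairDrift E F A B u v := by
  by_cases hu : u ∈ A ∪ B
  swap
  · rw [mem_union, not_or] at hu
    rw [drift_eq_zero E F hu.1 hu.2]
    simp [pairDrift, hu.1, hu.2]
  set A' := greedyStep E A u with hA'
  set B' := greedyStep F B u with hB'
  have hAA : A' ⊆ A := greedyStep_subset E A u
  have hBB : B' ⊆ B := greedyStep_subset F B u
  have huA : u ∉ A' := notMem_greedyStep E A u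
  have huB : u ∉ B' := notMem_greedyStep F B u
  set U := symmDiff E F with hU
  set N := univ.filter fun v => v ∈ A ∪ B ∧ v ≠ u ∧ s(u, v) ∈ U with hN
  have hedges : (U.filter fun e => ∀ v ∈ e, v ∈ A' ∪ B').card + N.card ≤
      (U.filter fun e => ∀ v ∈ e, v ∈ A ∪ B).card := by
    have hinj : Function.Injective fun v => s(u, v) := fun v w h => Sym2.congr_right.1 h
    rw [← card_image_of_injective N hinj, ← card_union_of_disjoint]
    · refine card_le_card fun e he => ?_
      rcases mem_union.1 he with he | he
      · rw [mem_filter] at he ⊢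
        exact ⟨he.1, fun v hv => union_subset_union hAA hBB (he.2 v hv)⟩
      · obtain ⟨v, hv, rfl⟩ := mem_image.1 he
        simp only [hN, mem_filter, mem_univ, true_and] at hv
        refine mem_filter.2 ⟨hv.2.2, fun w hw => ?_⟩
        rcases Sym2.mem_iff.1 hw with rfl | rfl
        · exact hu
        · exact hv.1
    · refine disjoint_left.2 fun e he he' => ?_
      obtain ⟨v, hv, rfl⟩ := mem_image.1 he'
      have := (mem_filter.1 he).2 u (Sym2.mem_mk_left u v)
      rcases mem_union.1 this with h | h
      · exact huA h
      · exact huB h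
  have hsum : ∑ v, pairDrift E F A B u v =
      ∑ v, (((if v ∈ symmDiff A' B' then 1 else 0) - (if v ∈ symmDiff A B then 1 else 0) -
        (if v ∈ A ∪ B ∧ v ≠ u ∧ s(u, v) ∈ U then 1 else 0)) +
        (if v = u then (if u ∈ symmDiff A B then 1 else 0) else 0) : ℤ) := by
    refine sum_congr rfl fun v _ => ?_
    rw [pairDrift, ← hA', ← hB', ← hU]
    by_cases hvu : v = u
    · subst hvu
      have : v ∉ symmDiff A' B' := by simp [mem_symmDiff, huA, huB]
      simp [this]
    · by_cases hv : v ∈ A ∪ B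
      · simp only [hu, hv, hvu, ne_eq, not_false_eq_true, and_self, true_and, if_true, if_false,
          add_zero]
      · have h := hv
        rw [mem_union, not_or] at h
        have h1 : v ∉ symmDiff A' B' := by
          simp [mem_symmDiff, mt (@hAA v) h.1, mt (@hBB v) h.2]
        have h2 : v ∉ symmDiff A B := by simp [mem_symmDiff, h.1, h.2]
        simp only [hv, h1, h2, hvu, false_and, and_false, if_false, sub_zero, add_zero]
  rw [hsum, sum_add_distrib, sum_sub_distrib, sum_sub_distrib, sum_ite_eq' univ u,
    if_pos (mem_univ u), sum_boole, sum_boole, sum_boole, ← hN, filter_univ_mem, filter_univ_mem,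
    drift, potential, potential, ← hA', ← hB', ← hU]
  push_cast
  have := (Nat.cast_le (α := ℤ)).2 hedges
  push_cast at this
  linarith

theorem sum_drift_nonpos {n : ℕ} (E F : Finset (Sym2 (Fin n))) (A B : Finset (Fin n)) :
    ∑ u, drift E F A B u ≤ 0 := by
  have h1 : ∑ u, drift E F A B u ≤ ∑ u, ∑ v, pairDrift E F A B u v :=
    sum_le_sum fun u _ => drift_le_sum_pairDrift E F A B u
  have h2 : ∑ u, ∑ v, pairDrift E F A B u v + ∑ u, ∑ v, pairDrift E F A B v u ≤ 0 := by
    simp_rw [← sum_add_distrib]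
    exact sum_nonpos fun u _ => sum_nonpos fun v _ => pairDrift_add_swap_nonpos E F A B u v
  rw [sum_comm (f := fun u v => pairDrift E F A B v u)] at h2
  linarith

theorem sum_perm_drift_nonpos {n : ℕ} (E F : Finset (Sym2 (Fin n))) (i : Fin n) :
    ∑ π : Equiv.Perm (Fin n), drift E F (available E π i) (available F π i) (π i) ≤ 0 := by
  have hswap : ∀ k ∈ univ.filter fun k : Fin n => i ≤ k,
      ∑ π : Equiv.Perm (Fin n), drift E F (available E π i) (available F π i) (π k) =
        ∑ π : Equiv.Perm (Fin n), drift E F (available E π i) (available F π i) (π i) := by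
    intro k hk
    have hik : (i : ℕ) ≤ k := (mem_filter.1 hk).2
    rw [← Equiv.sum_comp (Equiv.mulRight (Equiv.swap i k))]
    refine sum_congr rfl fun π _ => ?_
    rw [Equiv.coe_mulRight, available_mul_swap E π i k i le_rfl hik,
      available_mul_swap F π i k i le_rfl hik, Equiv.Perm.mul_apply, Equiv.swap_apply_right]
  have htotal : ∑ k ∈ univ.filter fun k : Fin n => i ≤ k,
      ∑ π : Equiv.Perm (Fin n), drift E F (available E π i) (available F π i) (π k) ≤ 0 := by
    rw [sum_comm]
    refine sum_nonpos fun π _ => ?_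
    have hearly : ∀ (D : Finset (Sym2 (Fin n))) (k : Fin n), ¬ i ≤ k →
        π k ∉ available D π i := by
      intro D k hk hmem
      have := ((mem_available D π _ i.2.le).1 hmem).1
      rw [Equiv.symm_apply_apply] at this
      exact hk this
    rw [sum_filter_of_ne fun k _ hne => by
      by_contra hk
      exact hne (drift_eq_zero E F (hearly E k hk) (hearly F k hk)),
      Equiv.sum_comp π (drift E F (available E π i) (available F π i))]
    exact sum_drift_nonpos E F _ _
  rw [sum_congr rfl hswap, sum_const, nsmul_eq_mul] at htotal
  have hpos : (0 : ℤ) < (univ.filter fun k : Fin n => i ≤ k).card := by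
    exact_mod_cast card_pos.2 ⟨i, mem_filter.2 ⟨mem_univ i, le_rfl⟩⟩
  exact nonpos_of_mul_nonpos_right htotal hpos

theorem ncard_symmDiff_LFMISOn_le {n : ℕ} (E F : Finset (Sym2 (Fin n)))
    (π : Equiv.Perm (Fin n)) :
    ((symmDiff (LFMISOn Set.univ (E : Set (Sym2 (Fin n))) π)
      (LFMISOn Set.univ (F : Set (Sym2 (Fin n))) π)).ncard : ℤ) ≤
      (symmDiff E F).card +
        ∑ i : Fin n, drift E F (available E π i) (available F π i) (π i) := by
  have hmem : ∀ (D : Finset (Sym2 (Fin n))) (i : Fin n),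
      π i ∈ LFMISOn Set.univ (D : Set (Sym2 (Fin n))) π ↔ π i ∈ available D π i := by
    intro D i
    simp only [LFMISOn, Set.mem_ofPred_eq, Set.mem_univ, true_and, Equiv.symm_apply_apply]
    exact lfmisAux_univ_iff D π i i.2
  have hcard : ((symmDiff (LFMISOn Set.univ (E : Set (Sym2 (Fin n))) π)
      (LFMISOn Set.univ (F : Set (Sym2 (Fin n))) π)).ncard : ℤ) =
      ∑ i : Fin n, if π i ∈ symmDiff (available E π i) (available F π i) then 1 else 0 := by
    classical
    rw [Set.ncard_eq_toFinset_card', ← filter_univ_mem (Set.toFinset _), ← sum_boole,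
      ← Equiv.sum_comp π]
    refine sum_congr rfl fun i _ => ?_
    simp only [Set.mem_toFinset, Set.mem_symmDiff, mem_symmDiff, hmem]
  have hdrift : ∀ i : Fin n, drift E F (available E π i) (available F π i) (π i) =
      (if π i ∈ symmDiff (available E π i) (available F π i) then 1 else 0) +
      ((potential (symmDiff E F) (available E π (i + 1)) (available F π (i + 1)) : ℤ) -
        potential (symmDiff E F) (available E π i) (available F π i)) := by
    intro i
    rw [drift, available, available, dif_pos i.2, dif_pos i.2]
    ring
  have htel := sum_range_sub (fun i => (potential (symmDiff E F) (available E π i)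
    (available F π i) : ℤ)) n
  rw [← Fin.sum_univ_eq_sum_range (fun i => (potential (symmDiff E F) (available E π (i + 1))
    (available F π (i + 1)) : ℤ) - potential (symmDiff E F) (available E π i)
    (available F π i)) n] at htel
  have h0 : potential (symmDiff E F) (available E π 0) (available F π 0) =
      (symmDiff E F).card := by
    simp [potential, available]
  rw [sum_congr rfl fun i _ => hdrift i, sum_add_distrib, htel, hcard, h0]
  have : (0 : ℤ) ≤ potential (symmDiff E F) (available E π n) (available F π n) :=
    Nat.cast_nonneg _
  linarith

theorem sum_ncard_symmDiff_LFMISOn_le {n : ℕ} (E F : Finset (Sym2 (Fin n))) :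
    ∑ π : Equiv.Perm (Fin n), (symmDiff (LFMISOn Set.univ (E : Set (Sym2 (Fin n))) π)
      (LFMISOn Set.univ (F : Set (Sym2 (Fin n))) π)).ncard ≤
      Fintype.card (Equiv.Perm (Fin n)) * (symmDiff E F).card := by
  have h := sum_le_sum fun π (_ : π ∈ univ) => ncard_symmDiff_LFMISOn_le E F π
  rw [sum_add_distrib, sum_const, nsmul_eq_mul, sum_comm] at h
  have hneg := sum_nonpos fun i (_ : i ∈ univ) => sum_perm_drift_nonpos E F i
  rw [card_univ] at h
  zify
  linarith

/-- Expected recourse of a batch of `b = |E₊| + |E₋|` edge updates: for a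
uniformly random permutation, the expected size of the symmetric difference of
`LFMIS((V,E),π)` and `LFMIS((V,E_new),π)`, where `E_new = (E ∪ E₊) \ E₋`, is at
most `b` (stated as: the sum over all permutations is at most `n! · b`). -/
theorem expected_recourse_le {n : ℕ} (G : SimpleGraph (Fin n)) [DecidableRel G.Adj]
    (Eplus Eminus : Finset (Sym2 (Fin n)))
    (hEp : ∀ e ∈ Eplus, ¬ e.IsDiag ∧ e ∉ G.edgeFinset)
    (hEm : Eminus ⊆ G.edgeFinset) :
    ∑ π : Equiv.Perm (Fin n),
        (symmDiff (LFMISOn Set.univ ↑G.edgeFinset π)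
          (LFMISOn Set.univ ↑((G.edgeFinset ∪ Eplus) \ Eminus) π)).ncard
      ≤ Fintype.card (Equiv.Perm (Fin n)) * (Eplus.card + Eminus.card) := by
  refine (sum_ncard_symmDiff_LFMISOn_le _ _).trans (Nat.mul_le_mul_left _ ?_)
  refine (card_le_card fun e he => ?_).trans (card_union_le Eplus Eminus)
  simp only [mem_symmDiff, mem_sdiff, mem_union] at he ⊢
  tauto
end

section
/- There exist constants c0 and k such that for every c ≥ c0 there exists n0 such that for all n ≥ n0: for every finite simple graph G on n vertices, every index 1 ≤ i ≤ n, and a permutation π of the vertices drawn uniformly at random, the probability that the remaining graph G_i (after greedily processing the first i−1 vertices) contains a vertex of degree greater than c·k·(n log n)/i is at most n^{−c}. (That is, the remaining graph after step i−1 of greedy LFMIS has maximum degree O((n log n)/i) with high probability.) -/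
open Finset

/-- The state has no undecided vertices and no undecided edges. -/
def MISState.Decided {n : ℕ} (st : MISState n) : Prop := st.uV = ∅ ∧ st.uE = ∅

namespace MISState.Decided

variable {n : ℕ} {st : MISState n}

theorem stepInf (h : st.Decided) (u : Fin n) : (stepInf st u).Decided := by
  obtain ⟨h1, h2⟩ := h
  unfold _root_.stepInf
  split_ifs with h3 h4
  · simp [h1] at h4
  · simp [MISState.Decided, h1, h2]
  · exact ⟨h1, h2⟩

theorem notMem_verts_stepInf_of_mem_nbrs (h : st.Decided) {u v : Fin n} (hv : v ∈ st.verts)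
    (hu : u ∈ st.nbrs v) : v ∉ (_root_.stepInf st u).verts := by
  obtain ⟨h1, h2⟩ := h
  simp only [MISState.nbrs, mem_filter] at hu
  obtain ⟨h3, h4, h5⟩ := hu
  rw [Sym2.eq_swap] at h5
  simp [_root_.stepInf, h1, h2, h3, MISState.nbrs, hv, h4.symm, h5]

end MISState.Decided

theorem stepInf_verts_subset {n : ℕ} (st : MISState n) (u : Fin n) :
    (stepInf st u).verts ⊆ st.verts := by
  unfold stepInf
  split_ifs
  · exact erase_subset _ _
  · exact sdiff_subset.trans (erase_subset _ _)
  · rfl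

theorem stepInf_edges_subset {n : ℕ} (st : MISState n) (u : Fin n) :
    (stepInf st u).edges ⊆ st.edges := by
  unfold stepInf
  split_ifs
  · exact filter_subset _ _
  · exact filter_subset _ _
  · rfl

theorem stepInf_nbrs_subset {n : ℕ} (st : MISState n) (u v : Fin n) :
    (stepInf st u).nbrs v ⊆ st.nbrs v := by
  intro w hw
  simp only [MISState.nbrs, mem_filter] at hw ⊢
  exact ⟨stepInf_verts_subset st u hw.1, hw.2.1, stepInf_edges_subset st u hw.2.2⟩

theorem notMem_verts_stepInf_self {n : ℕ} (st : MISState n) (u : Fin n) :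
    u ∉ (stepInf st u).verts := by
  unfold stepInf
  split_ifs with h1 h2
  · simp
  · simp
  · exact h1

theorem stateAt_succ {n : ℕ} (π : Equiv.Perm (Fin n)) (st0 : MISState n) {m : ℕ} (hm : m < n) :
    stateAt π st0 (m + 1) = stepInf (stateAt π st0 m) (π ⟨m, hm⟩) := by
  simp [stateAt, hm]

theorem decided_stateAt {n : ℕ} (π : Equiv.Perm (Fin n)) {st0 : MISState n} (h : st0.Decided)
    (m : ℕ) : (stateAt π st0 m).Decided := by
  induction m with
  | zero => exact h
  | succ m ih =>
    unfold stateAt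
    split_ifs
    · exact ih.stepInf _
    · exact ih

theorem notMem_verts_stateAt_of_lt {n : ℕ} (π : Equiv.Perm (Fin n)) (st0 : MISState n) {m : ℕ}
    (j : Fin n) (hj : (j : ℕ) < m) : π j ∉ (stateAt π st0 m).verts := by
  induction m with
  | zero => omega
  | succ m ih =>
    unfold stateAt
    split_ifs with h
    · rcases Nat.lt_succ_iff_lt_or_eq.mp hj with h1 | h1
      · exact fun h2 => ih h1 (stepInf_verts_subset _ _ h2)
      · subst h1
        exact notMem_verts_stepInf_self _ _
    · exact ih (by omega)

theorem stateAt_congr {n : ℕ} {π σ : Equiv.Perm (Fin n)} (st0 : MISState n) {m : ℕ}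
    (h : ∀ j : Fin n, (j : ℕ) < m → π j = σ j) : stateAt π st0 m = stateAt σ st0 m := by
  induction m with
  | zero => rfl
  | succ m ih =>
    simp only [stateAt]
    rw [ih fun j hj => h j (by omega)]
    split_ifs with hm
    · rw [h ⟨m, hm⟩ (by simp)]
    · rfl

/-- The permutations for which `v` is alive with degree greater than `d` before iteration `m`. -/
noncomputable def highDegreePerms {n : ℕ} (st0 : MISState n) (v : Fin n) (d : ℝ) (m : ℕ) :
    Finset (Equiv.Perm (Fin n)) :=
  univ.filter fun π => v ∈ (stateAt π st0 m).verts ∧ d < (((stateAt π st0 m).nbrs v).card : ℝ)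

theorem card_filter_apply_mem_nbrs_le {n : ℕ} (st0 : MISState n) (v : Fin n) (d : ℝ) {m : ℕ}
    (hm : m < n) (j : Fin n) :
    ((highDegreePerms st0 v d m).filter fun π => π j ∈ (stateAt π st0 m).nbrs v).card ≤
      ((highDegreePerms st0 v d m).filter
        fun π => π ⟨m, hm⟩ ∈ (stateAt π st0 m).nbrs v).card := by
  rcases lt_or_ge (j : ℕ) m with hj | hj
  · rw [filter_false_of_mem]
    · simp
    · intro π _ h
      exact notMem_verts_stateAt_of_lt π st0 j hj (mem_filter.mp h).1
  · refine card_le_card_of_injOn (fun π => π * Equiv.swap ⟨m, hm⟩ j) ?_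
      ((mul_left_injective _).injOn)
    intro π hπ
    have hst : stateAt (π * Equiv.swap ⟨m, hm⟩ j) st0 m = stateAt π st0 m := by
      refine stateAt_congr st0 fun l hl => ?_
      rw [Equiv.Perm.mul_apply, Equiv.swap_apply_of_ne_of_ne]
      · rintro rfl
        exact lt_irrefl _ hl
      · rintro rfl
        omega
    simp only [highDegreePerms, coe_filter, mem_filter, mem_univ, true_and, Set.mem_ofPred_eq]
      at hπ ⊢
    rw [hst]
    simpa using hπ

theorem card_highDegreePerms_succ_le {n : ℕ} {st0 : MISState n} (h0 : st0.Decided) (v : Fin n)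
    (d : ℝ) {m : ℕ} (hm : m < n) :
    ((highDegreePerms st0 v d (m + 1)).card : ℝ) ≤
      (1 - d / n) * (highDegreePerms st0 v d m).card := by
  set A := highDegreePerms st0 v d m with hA
  set B := A.filter fun π => π ⟨m, hm⟩ ∈ (stateAt π st0 m).nbrs v with hB
  have hn : (0 : ℝ) < n := by exact_mod_cast (by omega : 0 < n)
  have hsub : highDegreePerms st0 v d (m + 1) ⊆ A \ B := by
    intro π hπ
    simp only [highDegreePerms, mem_filter, mem_univ, true_and, stateAt_succ π st0 hm] at hπ
    have hv := stepInf_verts_subset _ _ hπ.1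
    simp only [mem_sdiff, hB, hA, highDegreePerms, mem_filter, mem_univ, true_and, not_and]
    refine ⟨⟨hv, hπ.2.trans_le ?_⟩, fun _ hmem => ?_⟩
    · exact_mod_cast card_le_card (stepInf_nbrs_subset _ _ _)
    · exact (decided_stateAt π h0 m).notMem_verts_stepInf_of_mem_nbrs hv hmem hπ.1
  have hcard : ((highDegreePerms st0 v d (m + 1)).card : ℝ) + B.card ≤ A.card := by
    have h1 := card_le_card hsub
    have h2 := card_sdiff_add_card_eq_card (show B ⊆ A from filter_subset _ _)
    exact_mod_cast (by omega : (highDegreePerms st0 v d (m + 1)).card + B.card ≤ A.card)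
  have hcount : ∑ π ∈ A, ((stateAt π st0 m).nbrs v).card ≤ n * B.card := by
    calc ∑ π ∈ A, ((stateAt π st0 m).nbrs v).card
        = ∑ π ∈ A, (univ.filter fun j => π j ∈ (stateAt π st0 m).nbrs v).card := by
          refine sum_congr rfl fun π _ => ?_
          refine (card_bij (fun j _ => π j) ?_ ?_ ?_).symm
          · simp
          · intro a _ b _ h
            exact π.injective h
          · intro b hb
            exact ⟨π.symm b, by simpa using hb, by simp⟩
      _ = ∑ j, (A.filter fun π => π j ∈ (stateAt π st0 m).nbrs v).card := by
          simp only [card_filter]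
          exact sum_comm
      _ ≤ ∑ _j : Fin n, B.card :=
          sum_le_sum fun j _ => card_filter_apply_mem_nbrs_le st0 v d hm j
      _ = n * B.card := by simp
  have hlow : d * A.card ≤ n * (B.card : ℝ) := by
    calc d * A.card = ∑ _π ∈ A, d := by rw [sum_const, nsmul_eq_mul, mul_comm]
      _ ≤ ∑ π ∈ A, (((stateAt π st0 m).nbrs v).card : ℝ) :=
          sum_le_sum fun π hπ => (mem_filter.mp hπ).2.2.le
      _ ≤ n * (B.card : ℝ) := by exact_mod_cast hcount
  have hlow' : d / n * A.card ≤ B.card := by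
    rw [div_mul_eq_mul_div, div_le_iff₀ hn]
    linarith
  linarith

theorem card_highDegreePerms_le {n : ℕ} {st0 : MISState n} (h0 : st0.Decided) (v : Fin n)
    (d : ℝ) {m : ℕ} (hm : m ≤ n) :
    ((highDegreePerms st0 v d m).card : ℝ) ≤
      Real.exp (-(d * m / n)) * Fintype.card (Equiv.Perm (Fin n)) := by
  induction m with
  | zero =>
    simp only [Nat.cast_zero, mul_zero, zero_div, neg_zero, Real.exp_zero, one_mul]
    exact_mod_cast card_le_univ _
  | succ m ih =>
    calc ((highDegreePerms st0 v d (m + 1)).card : ℝ)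
        ≤ (1 - d / n) * (highDegreePerms st0 v d m).card :=
          card_highDegreePerms_succ_le h0 v d hm
      _ ≤ Real.exp (-(d / n)) * (highDegreePerms st0 v d m).card :=
          mul_le_mul_of_nonneg_right (Real.one_sub_le_exp_neg _) (Nat.cast_nonneg _)
      _ ≤ Real.exp (-(d / n)) *
            (Real.exp (-(d * m / n)) * Fintype.card (Equiv.Perm (Fin n))) :=
          mul_le_mul_of_nonneg_left (ih (by omega)) (Real.exp_pos _).le
      _ = Real.exp (-(d * (m + 1 : ℕ) / n)) * Fintype.card (Equiv.Perm (Fin n)) := by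
          rw [← mul_assoc, ← Real.exp_add]
          congr 2
          push_cast
          ring

/-- With high probability, the graph remaining after step `i-1` of greedy
(random-order) LFMIS has maximum degree `O((n log n)/i)`: there exist constants
`c₀, k` such that for all `c ≥ c₀` and all sufficiently large `n`, for every
graph `G` on `n` vertices and every `1 ≤ i ≤ n`, the probability (over a uniform
permutation `π`) that the remaining graph `G_i` has a vertex of degree greater
than `c·k·(n log n)/i` is at most `n^{-c}`.  (Running `InfluenceMIS` with no
undecided input performs exactly the greedy eliminations, so `stateAt` with
empty undecided sets is the remaining graph.) -/
theorem remaining_degree_whp :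
    ∃ c0 k : ℝ, 0 < k ∧ ∀ c : ℝ, c0 ≤ c → ∃ n0 : ℕ, ∀ n : ℕ, n0 ≤ n →
      ∀ (G : SimpleGraph (Fin n)) [DecidableRel G.Adj], ∀ i : ℕ, 1 ≤ i → i ≤ n →
        ((Finset.univ.filter fun π : Equiv.Perm (Fin n) =>
            ∃ v ∈ (stateAt π (initState G ∅ ∅) (i - 1)).verts,
              c * k * ((n : ℝ) * Real.log n) / (i : ℝ) <
                (((stateAt π (initState G ∅ ∅) (i - 1)).nbrs v).card : ℝ)).card : ℝ)
          ≤ (Fintype.card (Equiv.Perm (Fin n)) : ℝ) * (n : ℝ) ^ (-c) := by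
  refine ⟨1, 4, by norm_num, fun c hc => ⟨3, fun n hn G _ i hi hin => ?_⟩⟩
  have hn3 : (3 : ℝ) ≤ n := by exact_mod_cast hn
  have hn0 : (0 : ℝ) < n := by linarith
  have hlog : 1 ≤ Real.log n := by
    rw [Real.le_log_iff_exp_le hn0]
    linarith [Real.exp_one_lt_d9]
  set d : ℝ := c * 4 * ((n : ℝ) * Real.log n) / (i : ℝ) with hd
  rcases Nat.eq_or_lt_of_le hi with rfl | hi2
  · rw [filter_false_of_mem]
    · simp only [card_empty, Nat.cast_zero]
      positivity
    · rintro π - ⟨v, -, hv⟩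
      have h1 : (((stateAt π (initState G ∅ ∅) (1 - 1)).nbrs v).card : ℝ) ≤ n := by
        exact_mod_cast (card_le_univ _).trans_eq (Fintype.card_fin n)
      have h2 : (n : ℝ) ≤ n * Real.log n := le_mul_of_one_le_right hn0.le hlog
      have h3 : (n : ℝ) * Real.log n ≤ c * 4 * (n * Real.log n) :=
        le_mul_of_one_le_left (hn0.le.trans h2) (by linarith)
      simp only [hd, Nat.cast_one, div_one] at hv
      linarith
  · have hi0 : (0 : ℝ) < i := by exact_mod_cast hi
    have hexp : Real.exp (-(d * (i - 1 : ℕ) / n)) ≤ (n : ℝ) ^ (-(2 * c)) := by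
      rw [Real.rpow_def_of_pos hn0, Real.exp_le_exp]
      have hi2' : (2 : ℝ) ≤ i := by exact_mod_cast hi2
      have hclog : 0 ≤ c * Real.log n := by nlinarith
      have key : d * (i - 1 : ℕ) / n = 4 * (c * Real.log n) * (i - 1) / i := by
        rw [hd, Nat.cast_sub hi]
        push_cast
        field_simp
      have : 2 * (c * Real.log n) ≤ d * (i - 1 : ℕ) / n := by
        rw [key, le_div_iff₀ hi0]
        nlinarith
      linarith
    have hdec : (initState G ∅ ∅).Decided := ⟨rfl, rfl⟩
    calc _ ≤ (((univ : Finset (Fin n)).biUnion fun v =>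
              highDegreePerms (initState G ∅ ∅) v d (i - 1)).card : ℝ) := by
          refine Nat.cast_le.mpr (card_le_card fun π hπ => ?_)
          obtain ⟨v, hv⟩ := (mem_filter.mp hπ).2
          exact mem_biUnion.mpr ⟨v, mem_univ v, mem_filter.mpr ⟨mem_univ π, hv⟩⟩
      _ ≤ ∑ v : Fin n, ((highDegreePerms (initState G ∅ ∅) v d (i - 1)).card : ℝ) := by
          exact_mod_cast card_biUnion_le
      _ ≤ ∑ _v : Fin n, (n : ℝ) ^ (-(2 * c)) * Fintype.card (Equiv.Perm (Fin n)) :=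
          sum_le_sum fun v _ => (card_highDegreePerms_le hdec v d (by omega)).trans
            (mul_le_mul_of_nonneg_right hexp (Nat.cast_nonneg _))
      _ = Fintype.card (Equiv.Perm (Fin n)) * (n : ℝ) ^ (1 + -(2 * c)) := by
          rw [sum_const, card_univ, Fintype.card_fin, nsmul_eq_mul, Real.rpow_add hn0,
            Real.rpow_one]
          ring
      _ ≤ Fintype.card (Equiv.Perm (Fin n)) * (n : ℝ) ^ (-c) :=
          mul_le_mul_of_nonneg_left
            (Real.rpow_le_rpow_of_exponent_le (by linarith) (by linarith)) (Nat.cast_nonneg _)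
end
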